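/- Let n ≥ 32 and ρ ∈ [1/n, 1/32]. Let G be the complete graph on vertex set {v_0, v_1, …, v_n} with edge weights w({v_i,v_j}) = 1 if |i−j| = 1 and w({v_i,v_j}) = 2 otherwise. Then every spanner H of G whose total edge weight satisfies w(H) ≤ (1+ρ)·n (i.e., lightness at most 1+ρ, since the MST of G is the path v_0,…,v_n of weight n) has average distortion dist_1(H,G) ≥ 1/(128ρ). -/

import Mathlib

open Finset

attribute [local instance] Classical.propDecidable

section Defs

variable {V : Type*} [Fintype V]

/-- Total weight of a (sub)graph: the sum of its edge weights. -/
noncomputable def wWeight (H : SimpleGraph V) (w : Sym2 V → ℝ) : ℝ :=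
  ∑ e ∈ H.edgeSet.toFinite.toFinset, w e

/-- Shortest-path distance in a weighted graph: infimum of walk weights. -/
noncomputable def wdist (G : SimpleGraph V) (w : Sym2 V → ℝ) (u v : V) : ℝ :=
  sInf {x : ℝ | ∃ p : G.Walk u v, x = (p.edges.map w).sum}

/-- `T` is a spanning tree of `G`. -/
def IsSpanningTree (G T : SimpleGraph V) : Prop :=
  T ≤ G ∧ T.IsTree

/-- Weight of a minimum spanning tree of `G`. -/
noncomputable def mstWeight (G : SimpleGraph V) (w : Sym2 V → ℝ) : ℝ :=
  sInf {x : ℝ | ∃ T : SimpleGraph V, IsSpanningTree G T ∧ x = wWeight T w}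

/-- `T` is a minimum spanning tree of `G`. -/
def IsMST (G : SimpleGraph V) (w : Sym2 V → ℝ) (T : SimpleGraph V) : Prop :=
  IsSpanningTree G T ∧ ∀ T' : SimpleGraph V, IsSpanningTree G T' → wWeight T w ≤ wWeight T' w

/-- A spanner of `G`: a connected spanning subgraph. -/
def IsSpanner (G H : SimpleGraph V) : Prop := H ≤ G ∧ H.Connected

/-- `G` together with `w` is a weighted graph: connected, positive pairwise-distinct
edge weights. -/
def IsWeightedGraph (G : SimpleGraph V) (w : Sym2 V → ℝ) : Prop :=
  G.Connected ∧ (∀ e ∈ G.edgeSet, 0 < w e) ∧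
    (∀ e ∈ G.edgeSet, ∀ e' ∈ G.edgeSet, e ≠ e' → w e ≠ w e')

/-- The ordered pairs of distinct vertices whose distortion in `H` is at most `t`. -/
noncomputable def goodPairs (G H : SimpleGraph V) (w : Sym2 V → ℝ) (t : ℝ) : Finset (V × V) :=
  Finset.univ.offDiag.filter (fun p => wdist H w p.1 p.2 ≤ t * wdist G w p.1 p.2)

/-- Scaling distortion `γ`: for every `ε ∈ (0,1)`, at least a `(1-ε)` fraction of the
pairs of distinct vertices have distortion at most `γ ε`.  (Counted over ordered pairs:
`n·(n-1) = 2·(n choose 2)`.) -/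
def HasScalingDistortion (G H : SimpleGraph V) (w : Sym2 V → ℝ) (γ : ℝ → ℝ) : Prop :=
  ∀ ε : ℝ, 0 < ε → ε < 1 →
    (1 - ε) * ((Fintype.card V : ℝ) * ((Fintype.card V : ℝ) - 1)) ≤
      ((goodPairs G H w (γ ε)).card : ℝ)

/-- The `ℓ_q`-distortion of the spanner `H` of `G`. -/
noncomputable def distq (G H : SimpleGraph V) (w : Sym2 V → ℝ) (q : ℝ) : ℝ :=
  ((∑ p ∈ (Finset.univ : Finset V).offDiag, (wdist H w p.1 p.2 / wdist G w p.1 p.2) ^ q) /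
    ((Fintype.card V : ℝ) * ((Fintype.card V : ℝ) - 1))) ^ (1 / q)

/-- `R(v,ε)`: the minimal radius `r` such that the ball `B(v,r)` contains at least `εn`
vertices. -/
noncomputable def Rgraph (G : SimpleGraph V) (w : Sym2 V → ℝ) (v : V) (ε : ℝ) : ℝ :=
  sInf {r : ℝ | 0 ≤ r ∧
    ε * (Fintype.card V : ℝ) ≤ ((Finset.univ.filter (fun u => wdist G w u v ≤ r)).card : ℝ)}

/-- Coarse scaling distortion `γ`: every pair of distinct vertices that are mutually
`ε/2`-far has distortion at most `γ ε`. -/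
def HasCoarseScalingDistortion (G H : SimpleGraph V) (w : Sym2 V → ℝ) (γ : ℝ → ℝ) : Prop :=
  ∀ ε : ℝ, 0 < ε → ε < 1 → ∀ u v : V, u ≠ v →
    Rgraph G w v (ε / 2) ≤ wdist G w u v → Rgraph G w u (ε / 2) ≤ wdist G w u v →
    wdist H w u v ≤ γ ε * wdist G w u v

end Defs

section WeightedDistance

variable {V : Type*}

lemma le_wdist {G : SimpleGraph V} (hG : G.Connected) {w : Sym2 V → ℝ} {u v : V} {r : ℝ}
    (h : ∀ p : G.Walk u v, r ≤ (p.edges.map w).sum) : r ≤ wdist G w u v := by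
  obtain ⟨p⟩ := hG.preconnected u v
  refine le_csInf ⟨_, p, rfl⟩ ?_
  rintro _ ⟨q, rfl⟩
  exact h q

lemma wdist_nonneg {G : SimpleGraph V} {w : Sym2 V → ℝ} (hw : ∀ e, 0 ≤ w e) (u v : V) :
    0 ≤ wdist G w u v := by
  refine Real.sInf_nonneg ?_
  rintro _ ⟨p, rfl⟩
  exact List.sum_nonneg (by simpa using fun e _ => hw e)

lemma wdist_le_of_adj {G : SimpleGraph V} {w : Sym2 V → ℝ} (hw : ∀ e, 0 ≤ w e) {u v : V}
    (h : G.Adj u v) : wdist G w u v ≤ w s(u, v) := by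
  refine csInf_le ⟨0, ?_⟩ ⟨h.toWalk, by simp⟩
  rintro _ ⟨p, rfl⟩
  exact List.sum_nonneg (by simpa using fun e _ => hw e)

lemma le_wdist_of_ne {G : SimpleGraph V} (hG : G.Connected) {w : Sym2 V → ℝ} {c : ℝ}
    (hc : 0 ≤ c) (hw : ∀ e, c ≤ w e) {u v : V} (h : u ≠ v) : c ≤ wdist G w u v := by
  refine le_wdist hG fun p => ?_
  cases p with
  | nil => exact absurd rfl h
  | cons hadj q =>
    have hq : 0 ≤ (q.edges.map w).sum :=
      List.sum_nonneg (by simpa using fun e _ => hc.trans (hw e))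
    rw [SimpleGraph.Walk.edges_cons, List.map_cons, List.sum_cons]
    exact le_add_of_le_of_nonneg (hw _) hq

/-- The endpoints of the edges of `H` of weight greater than `1`. -/
noncomputable def heavyVertices [Fintype V] (H : SimpleGraph V) (w : Sym2 V → ℝ) : Finset V :=
  (H.edgeSet.toFinite.toFinset.filter fun e => 1 < w e).biUnion Sym2.toFinset

lemma card_heavyVertices_le [Fintype V] {H : SimpleGraph V} (hH : H.Connected) {w : Sym2 V → ℝ}
    (hw : ∀ e, w e = 1 ∨ w e = 2) :
    ((heavyVertices H w).card : ℝ) ≤ 2 * (wWeight H w - (Fintype.card V - 1)) := by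
  set E := H.edgeSet.toFinite.toFinset with hE
  have hcard : (heavyVertices H w).card ≤ (E.filter fun e => 1 < w e).card * 2 :=
    card_biUnion_le_card_mul _ _ _ fun e _ => by
      rw [Sym2.card_toFinset]; split_ifs <;> norm_num
  have hweight : wWeight H w = E.card + (E.filter fun e => 1 < w e).card := by
    rw [wWeight, card_filter, card_eq_sum_ones]
    push_cast
    rw [← sum_add_distrib]
    refine sum_congr rfl fun e _ => ?_
    rcases hw e with h | h <;> rw [h] <;> norm_num
  have hedges : Fintype.card V ≤ E.card + 1 := by
    have h := hH.card_vert_le_card_edgeSet_add_one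
    rwa [Nat.card_eq_fintype_card, Nat.card_coe_set_eq,
      Set.ncard_eq_toFinset_card _ H.edgeSet.toFinite] at h
  have hcard' : ((heavyVertices H w).card : ℝ) ≤ (E.filter fun e => 1 < w e).card * 2 := by
    exact_mod_cast hcard
  have hedges' : (Fintype.card V : ℝ) ≤ E.card + 1 := by exact_mod_cast hedges
  linarith

lemma mem_heavyVertices [Fintype V] {H : SimpleGraph V} {w : Sym2 V → ℝ} {u v : V} (h : H.Adj u v)
    (hw : 1 < w s(u, v)) : u ∈ heavyVertices H w := by
  simp only [heavyVertices, mem_biUnion, mem_filter, Set.Finite.mem_toFinset]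
  exact ⟨s(u, v), ⟨h, hw⟩, by simp⟩

end WeightedDistance

/-- If the edges of weight at most `1` join consecutive integers, every walk either is as long as
the gap between its ends or reaches the end of a heavy edge. -/
lemma exists_abs_sub_le_walk_weight {m : ℕ} {H : SimpleGraph (Fin m)} {w : Sym2 (Fin m) → ℝ}
    (hw1 : ∀ e, 1 ≤ w e)
    (hlight : ∀ i j : Fin m, w s(i, j) ≤ 1 → |((i : ℕ) : ℤ) - ((j : ℕ) : ℤ)| ≤ 1)
    {u v : Fin m} (p : H.Walk u v) :
    ∃ t ∈ insert v (heavyVertices H w),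
      ((|((u : ℕ) : ℤ) - ((t : ℕ) : ℤ)| : ℤ) : ℝ) ≤ (p.edges.map w).sum := by
  induction p with
  | nil => exact ⟨_, mem_insert_self _ _, by simp⟩
  | @cons u x v hadj q ih =>
    have hq : 0 ≤ (q.edges.map w).sum :=
      List.sum_nonneg (by simpa using fun e _ => zero_le_one.trans (hw1 e))
    have hux := hw1 s(u, x)
    rw [SimpleGraph.Walk.edges_cons, List.map_cons, List.sum_cons]
    by_cases hheavy : 1 < w s(u, x)
    · refine ⟨u, mem_insert_of_mem (mem_heavyVertices hadj hheavy), ?_⟩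
      simp only [sub_self, abs_zero, Int.cast_zero]
      linarith
    · obtain ⟨t, ht, hxt⟩ := ih
      refine ⟨t, ht, ?_⟩
      have hle : |((u : ℕ) : ℤ) - ((t : ℕ) : ℤ)| ≤ 1 + |((x : ℕ) : ℤ) - ((t : ℕ) : ℤ)| :=
        (abs_sub_le _ ((x : ℕ) : ℤ) _).trans
          (add_le_add_left (hlight u x (not_lt.mp hheavy)) _)
      have hle' : ((|((u : ℕ) : ℤ) - ((t : ℕ) : ℤ)| : ℤ) : ℝ) ≤
          1 + ((|((x : ℕ) : ℤ) - ((t : ℕ) : ℤ)| : ℤ) : ℝ) := by exact_mod_cast hle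
      linarith

lemma card_filter_abs_sub_lt_le {m : ℕ} (t : Fin m) (L : ℕ) :
    (univ.filter fun u : Fin m => |((u : ℕ) : ℤ) - ((t : ℕ) : ℤ)| < L).card ≤ 2 * L - 1 := by
  have h := card_le_card_of_injOn (s := univ.filter fun u : Fin m =>
      |((u : ℕ) : ℤ) - ((t : ℕ) : ℤ)| < L) (t := Ioo ((t : ℕ) - L : ℤ) ((t : ℕ) + L : ℤ))
      (fun u => ((u : ℕ) : ℤ)) (fun u hu => by
        have hu' : |((u : ℕ) : ℤ) - ((t : ℕ) : ℤ)| < L := by simpa using hu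
        rw [abs_lt] at hu'
        simp only [coe_Ioo, Set.mem_Ioo]
        omega)
      (fun a _ b _ hab => Fin.ext (by simpa using hab))
  rw [Int.card_Ioo] at h
  omega

/-- The vertices from which `v` is at distance at least `L` carry a distance sum linear in `L`. -/
lemma mul_le_sum_wdist {m : ℕ} {H : SimpleGraph (Fin m)} (hH : H.Connected)
    {w : Sym2 (Fin m) → ℝ} (hw1 : ∀ e, 1 ≤ w e)
    (hlight : ∀ i j : Fin m, w s(i, j) ≤ 1 → |((i : ℕ) : ℤ) - ((j : ℕ) : ℤ)| ≤ 1)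
    (v : Fin m) {L : ℕ} (hL : 1 ≤ L) :
    (L : ℝ) * (m - ((heavyVertices H w).card + 1) * (2 * L - 1)) ≤ ∑ u, wdist H w u v := by
  set T := insert v (heavyVertices H w) with hT
  set B := T.biUnion fun t => univ.filter fun u : Fin m =>
    |((u : ℕ) : ℤ) - ((t : ℕ) : ℤ)| < L with hB
  have hBcard : B.card ≤ ((heavyVertices H w).card + 1) * (2 * L - 1) :=
    (card_biUnion_le_card_mul _ _ _ fun t _ => card_filter_abs_sub_lt_le t L).trans
      (Nat.mul_le_mul_right _ (card_insert_le _ _))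
  have hBcard' : (B.card : ℝ) ≤ ((heavyVertices H w).card + 1) * (2 * L - 1) := by
    have h : (B.card : ℝ) ≤ ((((heavyVertices H w).card + 1) * (2 * L - 1) : ℕ) : ℝ) := by
      exact_mod_cast hBcard
    rwa [Nat.cast_mul, Nat.cast_sub (by omega), Nat.cast_add, Nat.cast_mul, Nat.cast_one,
      Nat.cast_ofNat] at h
  have hcompl : (Bᶜ.card : ℝ) = m - B.card := by
    rw [card_compl, Nat.cast_sub (card_le_univ _), Fintype.card_fin]
  have hfar : ∀ u ∈ Bᶜ, (L : ℝ) ≤ wdist H w u v := fun u hu => le_wdist hH fun p => by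
    obtain ⟨t, ht, hle⟩ := exists_abs_sub_le_walk_weight hw1 hlight p
    have hut : (L : ℤ) ≤ |((u : ℕ) : ℤ) - ((t : ℕ) : ℤ)| := by
      by_contra! hlt
      exact mem_compl.mp hu (mem_biUnion.mpr ⟨t, ht, by simpa using hlt⟩)
    exact le_trans (by exact_mod_cast hut) hle
  calc (L : ℝ) * (m - ((heavyVertices H w).card + 1) * (2 * L - 1))
      ≤ L * Bᶜ.card := by
        rw [hcompl]
        gcongr
    _ = ∑ u ∈ Bᶜ, (L : ℝ) := by rw [sum_const, nsmul_eq_mul, mul_comm]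
    _ ≤ ∑ u ∈ Bᶜ, wdist H w u v := sum_le_sum hfar
    _ ≤ ∑ u, wdist H w u v :=
        sum_le_sum_of_subset_of_nonneg (subset_univ _) fun u _ _ =>
          wdist_nonneg (fun e => zero_le_one.trans (hw1 e)) u v

/-- When all weights are between `1` and `2`, the total distortion over the complete graph is at
least half the total distance in `H`. -/
lemma sum_sum_wdist_half_le {V : Type*} [Fintype V] [Nonempty V] {H : SimpleGraph V}
    {w : Sym2 V → ℝ} (hw1 : ∀ e, 1 ≤ w e) (hw2 : ∀ e, w e ≤ 2) :
    (∑ v, ∑ u, wdist H w u v) / 2 ≤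
      ∑ p ∈ (univ : Finset V).offDiag, wdist H w p.1 p.2 / wdist ⊤ w p.1 p.2 := by
  have hw0 : ∀ e, 0 ≤ w e := fun e => zero_le_one.trans (hw1 e)
  have hdiag : ∀ u : V, wdist H w u u = 0 := fun u =>
    le_antisymm (csInf_le ⟨0, by
      rintro _ ⟨p, rfl⟩
      exact List.sum_nonneg (by simpa using fun e _ => hw0 e)⟩
      ⟨SimpleGraph.Walk.nil, by simp⟩) (wdist_nonneg hw0 u u)
  have hsum : ∑ v, ∑ u, wdist H w u v = ∑ p ∈ (univ : Finset V).offDiag, wdist H w p.1 p.2 := by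
    rw [sum_comm, ← sum_product' (f := fun u v => wdist H w u v)]
    symm
    refine sum_subset (fun p _ => by simp) fun p _ hp => ?_
    have : p.1 = p.2 := by simpa using hp
    rw [this, hdiag]
  rw [hsum, sum_div]
  refine sum_le_sum fun p hp => ?_
  have hne : p.1 ≠ p.2 := by simpa using hp
  have hpos : 1 ≤ wdist (⊤ : SimpleGraph V) w p.1 p.2 :=
    le_wdist_of_ne SimpleGraph.connected_top zero_le_one hw1 hne
  exact div_le_div_of_nonneg_left (wdist_nonneg hw0 _ _) (by linarith)
    ((wdist_le_of_adj hw0 ((SimpleGraph.top_adj _ _).mpr hne)).trans (hw2 _))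

/-- (Lower bound.) Let `n ≥ 32`, `ρ ∈ [1/n, 1/32]`, and let `G` be the
complete graph on `{v_0,…,v_n} = Fin (n+1)` with weight `1` on path edges `{v_i,v_{i+1}}`
and `2` on all other edges.  Every spanner `H` of `G` with total weight at most
`(1+ρ)·n` (i.e. lightness at most `1+ρ`, the MST being the path of weight `n`) has
average distortion at least `1/(128ρ)`. -/
theorem stmt14 (n : ℕ) (hn : 32 ≤ n) (ρ : ℝ)
    (hρ1 : 1 / (n : ℝ) ≤ ρ) (hρ2 : ρ ≤ 1 / 32)
    (w : Sym2 (Fin (n + 1)) → ℝ)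
    (hw : ∀ i j : Fin (n + 1),
      w s(i, j) = if (i : ℕ) + 1 = (j : ℕ) ∨ (j : ℕ) + 1 = (i : ℕ) then 1 else 2)
    (H : SimpleGraph (Fin (n + 1))) (hHconn : H.Connected)
    (hHweight : wWeight H w ≤ (1 + ρ) * (n : ℝ)) :
    1 / (128 * ρ) ≤ distq (⊤ : SimpleGraph (Fin (n + 1))) H w 1 := by
  have hw12 : ∀ e, w e = 1 ∨ w e = 2 := by
    intro e
    induction e with
    | h i j => rw [hw]; split_ifs <;> simp
  have hw1 : ∀ e, 1 ≤ w e := fun e => by rcases hw12 e with h | h <;> rw [h]; norm_num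
  have hw2 : ∀ e, w e ≤ 2 := fun e => by rcases hw12 e with h | h <;> rw [h]; norm_num
  have hlight : ∀ i j : Fin (n + 1),
      w s(i, j) ≤ 1 → |((i : ℕ) : ℤ) - ((j : ℕ) : ℤ)| ≤ 1 := by
    intro i j h
    rw [hw] at h
    split_ifs at h with hij
    · rw [abs_le]; omega
    · norm_num at h
  have hn0 : (0 : ℝ) < n := by exact_mod_cast (by omega : 0 < n)
  have hρ0 : 0 < ρ := (by positivity : (0 : ℝ) < 1 / n).trans_le hρ1
  have hρn : 1 ≤ ρ * n := by rwa [div_le_iff₀ hn0] at hρ1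
  have hS : ((heavyVertices H w).card : ℝ) + 1 ≤ 3 * (ρ * n) := by
    have h := card_heavyVertices_le hHconn hw12
    rw [Fintype.card_fin] at h
    push_cast at h
    linarith
  set L := ⌊(1 / (6 * ρ) + 1) / 2⌋₊ with hLdef
  have hinv : 32 ≤ 1 / ρ := by
    rw [le_div_iff₀ hρ0]; linarith
  have hsix : 1 / (6 * ρ) = 1 / ρ / 6 := by field_simp
  have hLle : (L : ℝ) ≤ (1 / (6 * ρ) + 1) / 2 := Nat.floor_le (by positivity)
  have hLlt : (1 / (6 * ρ) + 1) / 2 < L + 1 := Nat.lt_floor_add_one _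
  have hL1 : 1 ≤ L := Nat.le_floor (by rw [hsix]; push_cast; linarith)
  have hL1' : (1 : ℝ) ≤ L := by exact_mod_cast hL1
  have hLρ : 1 / ρ / 32 ≤ L := by rw [hsix] at hLlt; linarith
  have hbad : (((heavyVertices H w).card : ℝ) + 1) * (2 * L - 1) ≤ n / 2 :=
    calc (((heavyVertices H w).card : ℝ) + 1) * (2 * L - 1)
        ≤ 3 * (ρ * n) * (1 / (6 * ρ)) := by
          apply mul_le_mul hS (by linarith) (by linarith) (by positivity)
      _ = n / 2 := by field_simp; norm_num
  have hrow : ∀ v, 1 / ρ / 32 * (n / 2) ≤ ∑ u, wdist H w u v := fun v => by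
    refine le_trans ?_ (mul_le_sum_wdist hHconn hw1 hlight v hL1)
    push_cast
    exact mul_le_mul hLρ (by linarith) (by positivity) (by positivity)
  have htotal : ((n : ℝ) + 1) * (1 / ρ / 32 * (n / 2)) ≤ ∑ v, ∑ u, wdist H w u v := by
    have h := sum_le_sum fun v (_ : v ∈ (univ : Finset (Fin (n + 1)))) => hrow v
    rw [sum_const, card_univ, Fintype.card_fin, nsmul_eq_mul] at h
    exact_mod_cast h
  have hratio := sum_sum_wdist_half_le (H := H) hw1 hw2
  simp only [distq, Real.rpow_one, div_one]
  rw [Fintype.card_fin, le_div_iff₀ (by push_cast; nlinarith)]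
  refine le_trans ?_ ((div_le_div_of_nonneg_right htotal zero_le_two).trans hratio)
  push_cast
  apply le_of_eq
  field_simp
  ring
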